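/- (de Bruijn's identity) Let X be a real random variable with finite variance and let Z be a standard normal random variable independent of X. Then for every t > 0, d/dt H(X + √t·Z) = (1/2)·J(X + √t·Z), where H denotes differential entropy and J denotes Fisher information. -/

import Mathlib

open MeasureTheory ProbabilityTheory Real

/-- The density of `X + √t·Z` (Gaussian smoothing of the law `μ` of `X` at time `t`):
`f_t(y) = ∫ (2πt)^{-1/2} · exp(-(y-x)²/(2t)) dμ(x)`. -/
noncomputable def heatDensity (μ : Measure ℝ) (t : ℝ) (y : ℝ) : ℝ :=
  ∫ x, (Real.sqrt (2 * Real.pi * t))⁻¹ * Real.exp (-(y - x) ^ 2 / (2 * t)) ∂μ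

/-- The differential entropy `H(X + √t·Z) = -∫ f_t(y) log f_t(y) dy` of the Gaussian
smoothing at time `t` of the law `μ` of `X`. -/
noncomputable def smoothedEntropy (μ : Measure ℝ) (t : ℝ) : ℝ :=
  -∫ y, heatDensity μ t y * Real.log (heatDensity μ t y)

/-- The Fisher information `J(X + √t·Z) = ∫ (f_t'(y))²/f_t(y) dy` of the Gaussian
smoothing at time `t` of the law `μ` of `X`. -/
noncomputable def smoothedFisherInfo (μ : Measure ℝ) (t : ℝ) : ℝ :=
  ∫ y, (deriv (heatDensity μ t) y) ^ 2 / heatDensity μ t y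

/-- An envelope dominating the Gaussian kernel and its derivatives. -/
noncomputable def gaussianEnvelope (c u : ℝ) : ℝ := (1 + u ^ 2) * Real.exp (-u ^ 2 / c)

lemma gaussianEnvelope_nonneg (c u : ℝ) : 0 ≤ gaussianEnvelope c u := by
  unfold gaussianEnvelope; positivity

lemma continuous_gaussianEnvelope (c : ℝ) : Continuous (gaussianEnvelope c) := by
  unfold gaussianEnvelope; fun_prop

lemma gaussianEnvelope_le {c : ℝ} (hc : 0 < c) (u : ℝ) : gaussianEnvelope c u ≤ 1 + c := by
  have h1 : u ^ 2 / c + 1 ≤ Real.exp (u ^ 2 / c) := Real.add_one_le_exp _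
  have h2 : Real.exp (-u ^ 2 / c) = (Real.exp (u ^ 2 / c))⁻¹ := by
    rw [← Real.exp_neg]; ring_nf
  unfold gaussianEnvelope
  rw [h2, ← div_eq_mul_inv, div_le_iff₀ (Real.exp_pos _)]
  have h3 : (1 + c) * (u ^ 2 / c + 1) = 1 + u ^ 2 + u ^ 2 / c + c := by field_simp; ring
  have h4 : 0 ≤ u ^ 2 / c := by positivity
  nlinarith [mul_le_mul_of_nonneg_left h1 (by linarith : 0 ≤ 1 + c)]

lemma integrable_gaussianEnvelope_mul {c : ℝ} (hc : 0 < c) :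
    Integrable (fun u => gaussianEnvelope c u * (1 + u ^ 2)) := by
  have hb : 0 < c⁻¹ := inv_pos.2 hc
  have h2 := integrable_rpow_mul_exp_neg_mul_sq hb (s := (2 : ℕ)) (by norm_num)
  have h4 := integrable_rpow_mul_exp_neg_mul_sq hb (s := (4 : ℕ)) (by norm_num)
  have h0 := integrable_exp_neg_mul_sq hb
  simp only [Real.rpow_natCast] at h2 h4
  refine ((h0.add (h2.const_mul 2)).add h4).congr (ae_of_all _ fun u => ?_)
  simp only [Pi.add_apply, gaussianEnvelope]
  rw [show -u ^ 2 / c = -c⁻¹ * u ^ 2 by field_simp]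
  ring

section Smoothing

variable {μ : Measure ℝ} [IsProbabilityMeasure μ]

lemma stronglyMeasurable_smoothing {w : ℝ → ℝ} (hw : Continuous w) :
    StronglyMeasurable (fun y => ∫ x, w (y - x) ∂μ) :=
  StronglyMeasurable.integral_prod_right (f := fun y x => w (y - x))
    (by apply Continuous.stronglyMeasurable; unfold Function.uncurry; fun_prop)

lemma integrable_comp_sub {w : ℝ → ℝ} (hw : Continuous w) {c K : ℝ} (hc : 0 < c) (hK : 0 ≤ K)
    (hwK : ∀ u, |w u| ≤ K * gaussianEnvelope c u) (y : ℝ) :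
    Integrable (fun x => w (y - x)) μ := by
  refine Integrable.mono' (integrable_const (K * (1 + c)))
    (by fun_prop : Continuous fun x => w (y - x)).aestronglyMeasurable
    (ae_of_all _ fun x => (hwK _).trans ?_)
  exact mul_le_mul_of_nonneg_left (gaussianEnvelope_le hc _) hK

lemma abs_smoothing_le {w : ℝ → ℝ} {c K : ℝ} (hc : 0 < c)
    (hwK : ∀ u, |w u| ≤ K * gaussianEnvelope c u) (y : ℝ) :
    |∫ x, w (y - x) ∂μ| ≤ K * ∫ x, gaussianEnvelope c (y - x) ∂μ := by
  rw [← integral_const_mul]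
  refine norm_integral_le_of_norm_le (f := fun x => w (y - x)) (Integrable.const_mul ?_ K)
    (ae_of_all _ fun x => hwK _)
  exact integrable_comp_sub (continuous_gaussianEnvelope c) hc zero_le_one
    (fun u => by rw [abs_of_nonneg (gaussianEnvelope_nonneg c u), one_mul]) y

lemma integrable_envelope_smoothing (hμ : Integrable (fun x => x ^ 2) μ) {c : ℝ} (hc : 0 < c) :
    Integrable (fun y => (∫ x, gaussianEnvelope c (y - x) ∂μ) * (1 + y ^ 2)) := by
  have hcont : Continuous fun p : ℝ × ℝ => gaussianEnvelope c (p.2 - p.1) := by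
    have := continuous_gaussianEnvelope c; fun_prop
  have key : Integrable (fun p : ℝ × ℝ => gaussianEnvelope c (p.2 - p.1) *
      (1 + (p.2 - p.1) ^ 2) * (1 + p.1 ^ 2)) (μ.prod volume) := by
    rw [integrable_prod_iff (by apply Continuous.aestronglyMeasurable; fun_prop)]
    constructor
    · exact ae_of_all _ fun x =>
        ((integrable_gaussianEnvelope_mul hc).comp_sub_right x).mul_const (1 + x ^ 2)
    · have : ∀ x : ℝ, ∫ y, ‖gaussianEnvelope c (y - x) * (1 + (y - x) ^ 2) * (1 + x ^ 2)‖
          = (∫ u, gaussianEnvelope c u * (1 + u ^ 2)) * (1 + x ^ 2) := by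
        intro x
        rw [← integral_sub_right_eq_self (fun u => gaussianEnvelope c u * (1 + u ^ 2)) x,
          ← integral_mul_const]
        refine integral_congr_ae (ae_of_all _ fun y => ?_)
        have := gaussianEnvelope_nonneg c (y - x)
        exact Real.norm_of_nonneg (by positivity)
      simp only [this]
      exact ((integrable_const 1).add hμ).const_mul _
  have key2 : Integrable (fun p : ℝ × ℝ => gaussianEnvelope c (p.2 - p.1) * (1 + p.2 ^ 2))
      (μ.prod volume) := by
    refine Integrable.mono' (key.const_mul 2)
      (by apply Continuous.aestronglyMeasurable; fun_prop) (ae_of_all _ fun p => ?_)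
    have h := gaussianEnvelope_nonneg c (p.2 - p.1)
    rw [Real.norm_of_nonneg (by positivity)]
    have : 1 + p.2 ^ 2 ≤ 2 * ((1 + (p.2 - p.1) ^ 2) * (1 + p.1 ^ 2)) := by
      nlinarith [sq_nonneg (p.2 - 2 * p.1), mul_nonneg (sq_nonneg (p.2 - p.1)) (sq_nonneg p.1)]
    nlinarith [mul_le_mul_of_nonneg_left this h]
  have := key2.integral_prod_right
  simpa only [integral_mul_const] using this

lemma integrable_smoothing_mul (hμ : Integrable (fun x => x ^ 2) μ) {w h : ℝ → ℝ}
    (hw : Continuous w) {c K A : ℝ} (hc : 0 < c)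
    (hwK : ∀ u, |w u| ≤ K * gaussianEnvelope c u) (hh : Measurable h)
    (hA : ∀ y, |h y| ≤ A * (1 + y ^ 2)) :
    Integrable (fun y => (∫ x, w (y - x) ∂μ) * h y) := by
  refine Integrable.mono' ((integrable_envelope_smoothing hμ hc).const_mul (K * A))
    ((stronglyMeasurable_smoothing hw).aestronglyMeasurable.mul hh.aestronglyMeasurable)
    (ae_of_all _ fun y => ?_)
  have h1 := abs_smoothing_le (μ := μ) hc hwK y
  rw [Real.norm_eq_abs, abs_mul]
  calc _ ≤ _ := mul_le_mul h1 (hA y) (abs_nonneg _) ((abs_nonneg _).trans h1)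
    _ = _ := by ring

lemma hasDerivAt_smoothing {w w' : ℝ → ℝ} (hw : Continuous w) (hw' : Continuous w')
    (hd : ∀ u, HasDerivAt w (w' u) u) {c K : ℝ} (hc : 0 < c) (hK : 0 ≤ K)
    (hwK : ∀ u, |w u| ≤ K * gaussianEnvelope c u)
    (hwK' : ∀ u, |w' u| ≤ K * gaussianEnvelope c u) (y : ℝ) :
    HasDerivAt (fun y => ∫ x, w (y - x) ∂μ) (∫ x, w' (y - x) ∂μ) y := by
  refine (hasDerivAt_integral_of_dominated_loc_of_deriv_le (F := fun y x => w (y - x))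
    (F' := fun y x => w' (y - x)) (bound := fun _ => K * (1 + c)) Filter.univ_mem
    (Filter.Eventually.of_forall fun y =>
      (by fun_prop : Continuous fun x => w (y - x)).aestronglyMeasurable)
    (integrable_comp_sub hw hc hK hwK y)
    (by fun_prop : Continuous fun x => w' (y - x)).aestronglyMeasurable
    (ae_of_all _ fun x z _ => (hwK' _).trans
      (mul_le_mul_of_nonneg_left (gaussianEnvelope_le hc _) hK))
    (integrable_const _) (ae_of_all _ fun x z _ => ?_)).2
  exact (hd (z - x)).comp_sub_const z x

end Smoothing

/-- The centred Gaussian density of variance `s`. -/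
noncomputable def heatKernel (s u : ℝ) : ℝ :=
  (Real.sqrt (2 * Real.pi * s))⁻¹ * Real.exp (-u ^ 2 / (2 * s))

lemma heatDensity_eq (μ : Measure ℝ) (s y : ℝ) :
    heatDensity μ s y = ∫ x, heatKernel s (y - x) ∂μ := rfl

lemma continuous_heatKernel (s : ℝ) : Continuous (heatKernel s) := by
  unfold heatKernel; fun_prop

lemma heatKernel_pos {s : ℝ} (hs : 0 < s) (u : ℝ) : 0 < heatKernel s u := by
  unfold heatKernel; positivity

lemma hasDerivAt_heatKernel {s : ℝ} (hs : 0 < s) (u : ℝ) :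
    HasDerivAt (heatKernel s) (-(u / s) * heatKernel s u) u := by
  unfold heatKernel
  have h := ((((hasDerivAt_id u).pow 2).neg.div_const (2 * s)).exp).const_mul
    (Real.sqrt (2 * Real.pi * s))⁻¹
  refine h.congr_deriv ?_
  simp
  field_simp

lemma hasDerivAt_heatKernel_deriv {s : ℝ} (hs : 0 < s) (u : ℝ) :
    HasDerivAt (fun u => -(u / s) * heatKernel s u)
      ((u ^ 2 / s ^ 2 - 1 / s) * heatKernel s u) u := by
  have h := (((hasDerivAt_id u).div_const s).neg).mul (hasDerivAt_heatKernel hs u)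
  refine h.congr_deriv ?_
  simp
  field_simp
  ring

lemma hasDerivAt_heatKernel_time {s : ℝ} (hs : 0 < s) (u : ℝ) :
    HasDerivAt (fun s => heatKernel s u)
      (1 / 2 * ((u ^ 2 / s ^ 2 - 1 / s) * heatKernel s u)) s := by
  unfold heatKernel
  have hpos : 0 < 2 * Real.pi * s := by positivity
  have h1 := (((hasDerivAt_id s).const_mul (2 * Real.pi)).sqrt (by simpa using hpos.ne')).inv
    (by simpa using (Real.sqrt_pos.2 hpos).ne')
  have h2 := ((((hasDerivAt_id s).const_mul 2).inv (by simpa using hs.ne')).const_mul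
    (-u ^ 2)).exp
  refine (h1.mul h2).congr_deriv ?_
  simp only [id, Pi.inv_apply, mul_one, Real.sq_sqrt hpos.le, ← div_eq_mul_inv]
  have h3 := Real.sqrt_pos.2 hpos
  field_simp
  ring

/-- The kernel, its first two derivatives and its second-moment weight are uniformly dominated
for times close to `t`. -/
lemma exists_heatKernel_bound {t : ℝ} (ht : 0 < t) :
    ∃ K, 0 ≤ K ∧ ∀ s ∈ Set.Ioo (t / 2) (2 * t), ∀ p : ℝ → ℝ, ∀ u,
      |p u| ≤ (1 + 2 / t + 4 / t ^ 2) * (1 + u ^ 2) →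
      |p u * heatKernel s u| ≤ K * gaussianEnvelope (4 * t) u := by
  refine ⟨(1 + 2 / t + 4 / t ^ 2) * (Real.sqrt (Real.pi * t))⁻¹, by positivity,
    fun s hs p u hp => ?_⟩
  obtain ⟨hs1, hs2⟩ := hs
  have hs0 : 0 < s := by linarith
  have hk : heatKernel s u ≤ (Real.sqrt (Real.pi * t))⁻¹ * Real.exp (-u ^ 2 / (4 * t)) := by
    unfold heatKernel
    gcongr ?_ * Real.exp ?_
    · refine inv_anti₀ (by positivity) (Real.sqrt_le_sqrt ?_)
      nlinarith [Real.pi_pos]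
    · rw [neg_div, neg_div, neg_le_neg_iff]
      exact div_le_div_of_nonneg_left (sq_nonneg u) (by positivity) (by linarith)
  rw [abs_mul, abs_of_pos (heatKernel_pos hs0 u)]
  calc _ ≤ _ := mul_le_mul hp hk (heatKernel_pos hs0 u).le (by positivity)
    _ = _ := by unfold gaussianEnvelope; ring

lemma abs_heat_weights_le {t s : ℝ} (ht : 0 < t) (hs : s ∈ Set.Ioo (t / 2) (2 * t)) (u : ℝ) :
    |u / s| ≤ (1 + 2 / t + 4 / t ^ 2) * (1 + u ^ 2) ∧
    |u ^ 2 / s ^ 2| ≤ (1 + 2 / t + 4 / t ^ 2) * (1 + u ^ 2) ∧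
    |u ^ 2 / s ^ 2 - 1 / s| ≤ (1 + 2 / t + 4 / t ^ 2) * (1 + u ^ 2) := by
  obtain ⟨hs1, hs2⟩ := hs
  have hs0 : 0 < s := by linarith
  have hi : 1 / s ≤ 2 / t := by rw [div_le_div_iff₀ hs0 ht]; linarith
  have hi0 : 0 < 1 / s := by positivity
  have hb : 0 < 2 / t := by positivity
  rw [show 4 / t ^ 2 = (2 / t) ^ 2 by ring, show u ^ 2 / s ^ 2 = u ^ 2 * (1 / s) ^ 2 by ring,
    show u / s = u * (1 / s) by ring]
  generalize 1 / s = a at *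
  generalize 2 / t = b at *
  have ha2 : a ^ 2 ≤ b ^ 2 := by gcongr
  have hu := sq_nonneg u
  have hua : u ^ 2 * a ^ 2 ≤ u ^ 2 * b ^ 2 := by gcongr
  have hub : 0 ≤ u ^ 2 * b := by positivity
  have hu1 : |u| ≤ 1 + u ^ 2 := by
    rw [← sq_abs u]; nlinarith [sq_nonneg (|u| - 1), abs_nonneg u]
  have hb2 := sq_nonneg b
  have hua0 : 0 ≤ u ^ 2 * a ^ 2 := by positivity
  refine ⟨?_, ?_, ?_⟩
  · rw [abs_mul, abs_of_pos hi0]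
    nlinarith [mul_le_mul hu1 hi hi0.le (by positivity)]
  · rw [abs_of_nonneg hua0]
    nlinarith
  · rw [abs_le]
    constructor <;> nlinarith

section HeatDensity

variable {μ : Measure ℝ} [IsProbabilityMeasure μ]

lemma integrable_heatKernel {s : ℝ} (y : ℝ) (hs : 0 < s) :
    Integrable (fun x => heatKernel s (y - x)) μ := by
  refine Integrable.mono' (integrable_const (Real.sqrt (2 * Real.pi * s))⁻¹)
    ((continuous_heatKernel s).comp (by fun_prop)).aestronglyMeasurable (ae_of_all _ fun x => ?_)
  rw [Real.norm_of_nonneg (heatKernel_pos hs _).le]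
  unfold heatKernel
  refine mul_le_of_le_one_right (by positivity) (Real.exp_le_one_iff.2 ?_)
  rw [neg_div, neg_nonpos]
  positivity

lemma heatDensity_pos {s : ℝ} (hs : 0 < s) (y : ℝ) : 0 < heatDensity μ s y := by
  rw [heatDensity_eq, integral_pos_iff_support_of_nonneg
    (fun x => (heatKernel_pos hs _).le) (integrable_heatKernel y hs)]
  have : Function.support (fun x => heatKernel s (y - x)) = Set.univ := by
    ext x; simpa using (heatKernel_pos hs _).ne'
  rw [this]; simp

lemma heatDensity_le {s : ℝ} (hs : 0 < s) (y : ℝ) :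
    heatDensity μ s y ≤ (Real.sqrt (2 * Real.pi * s))⁻¹ := by
  have h := integral_mono (μ := μ) (integrable_heatKernel y hs)
    (integrable_const (Real.sqrt (2 * Real.pi * s))⁻¹) (fun x => by
      unfold heatKernel
      refine mul_le_of_le_one_right (by positivity) (Real.exp_le_one_iff.2 ?_)
      rw [neg_div, neg_nonpos]
      positivity)
  simpa [heatDensity_eq] using h

/-- Jensen's inequality for the exponential. -/
lemma le_heatDensity (hμ : Integrable (fun x => x ^ 2) μ) {s : ℝ} (hs : 0 < s) (y : ℝ) :
    (Real.sqrt (2 * Real.pi * s))⁻¹ *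
      Real.exp (-(2 * y ^ 2 + 2 * ∫ x, x ^ 2 ∂μ) / (2 * s)) ≤ heatDensity μ s y := by
  set m := ∫ x, x ^ 2 ∂μ with hm
  set a := -(2 * y ^ 2 + 2 * m) / (2 * s) with ha
  have hint : Integrable (fun x => (Real.sqrt (2 * Real.pi * s))⁻¹ *
      (Real.exp a * (-(2 * y ^ 2 + 2 * x ^ 2) / (2 * s) - a + 1))) μ := by
    refine Integrable.const_mul (Integrable.const_mul ?_ _) _
    exact (((((integrable_const _).add (hμ.const_mul 2)).neg.div_const _).sub
      (integrable_const a)).add (integrable_const 1))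
  have hval : ∫ x, (Real.sqrt (2 * Real.pi * s))⁻¹ *
      (Real.exp a * (-(2 * y ^ 2 + 2 * x ^ 2) / (2 * s) - a + 1)) ∂μ
      = (Real.sqrt (2 * Real.pi * s))⁻¹ * Real.exp a := by
    have h1 : ∫ x, (2 * y ^ 2 + 2 * x ^ 2) ∂μ = 2 * y ^ 2 + 2 * m := by
      rw [integral_add (integrable_const _) (hμ.const_mul 2), integral_const_mul 2 (fun x : ℝ => x ^ 2)]
      simp [hm]
    have h2 : Integrable (fun x => -(2 * y ^ 2 + 2 * x ^ 2) / (2 * s)) μ :=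
      ((integrable_const _).add (hμ.const_mul 2)).neg.div_const _
    have h3 : Integrable (fun x => -(2 * y ^ 2 + 2 * x ^ 2) / (2 * s) - a) μ :=
      h2.sub (integrable_const a)
    rw [integral_const_mul, integral_const_mul, integral_add h3 (integrable_const 1),
      integral_sub h2 (integrable_const a), integral_div, integral_neg, h1]
    simp [ha]
  rw [← hval, heatDensity_eq]
  refine integral_mono hint (integrable_heatKernel y hs) fun x => ?_
  unfold heatKernel
  refine mul_le_mul_of_nonneg_left ?_ (by positivity)
  set b := -(2 * y ^ 2 + 2 * x ^ 2) / (2 * s) with hb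
  calc Real.exp a * (b - a + 1) ≤ Real.exp a * Real.exp (b - a) := by
        gcongr; exact Real.add_one_le_exp _
    _ = Real.exp b := by rw [← Real.exp_add]; ring_nf
    _ ≤ _ := by
        gcongr
        rw [hb]
        gcongr
        nlinarith [sq_nonneg (y + x)]

lemma exists_log_heatDensity_bound (hμ : Integrable (fun x => x ^ 2) μ) {t : ℝ} (ht : 0 < t) :
    ∃ A, ∀ s ∈ Set.Ioo (t / 2) (2 * t), ∀ y,
      |Real.log (heatDensity μ s y)| + 1 ≤ A * (1 + y ^ 2) := by
  set m := ∫ x, x ^ 2 ∂μ with hm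
  have hm0 : 0 ≤ m := integral_nonneg fun x => sq_nonneg x
  set L := |Real.log (Real.sqrt (Real.pi * t))| + |Real.log (Real.sqrt (4 * Real.pi * t))| with hL
  refine ⟨L + (2 + 2 * m) / t + 1, fun s hs y => ?_⟩
  obtain ⟨hs1, hs2⟩ := hs
  have hs0 : 0 < s := by linarith
  have hlo := le_heatDensity hμ hs0 y
  have hup := heatDensity_le (μ := μ) hs0 y
  have hpos := heatDensity_pos (μ := μ) hs0 y
  have hsq : 0 < Real.sqrt (2 * Real.pi * s) := by positivity
  have hup' := Real.log_le_log hpos hup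
  have hlo' := Real.log_le_log (by positivity) hlo
  rw [Real.log_mul (by positivity) (by positivity), Real.log_exp, Real.log_inv] at hlo'
  rw [Real.log_inv] at hup'
  have h1 : Real.log (Real.sqrt (Real.pi * t)) ≤ Real.log (Real.sqrt (2 * Real.pi * s)) := by
    refine Real.log_le_log (by positivity) (Real.sqrt_le_sqrt ?_)
    nlinarith [Real.pi_pos]
  have h2 : Real.log (Real.sqrt (2 * Real.pi * s)) ≤ Real.log (Real.sqrt (4 * Real.pi * t)) := by
    refine Real.log_le_log (by positivity) (Real.sqrt_le_sqrt ?_)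
    nlinarith [Real.pi_pos]
  have h3 : (2 * y ^ 2 + 2 * m) / (2 * s) ≤ (2 * y ^ 2 + 2 * m) / t := by
    gcongr; linarith
  rw [neg_div] at hlo'
  have h4 : (2 * y ^ 2 + 2 * m) / t ≤ (2 + 2 * m) / t * (1 + y ^ 2) := by
    rw [div_mul_eq_mul_div]
    gcongr
    nlinarith [mul_nonneg hm0 (sq_nonneg y)]
  have h5 : 0 ≤ (2 * y ^ 2 + 2 * m) / t := by positivity
  have h6 : |Real.log (heatDensity μ s y)| ≤ L + (2 * y ^ 2 + 2 * m) / t := by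
    rw [abs_le]
    have ha := neg_abs_le (Real.log (Real.sqrt (Real.pi * t)))
    have hb := le_abs_self (Real.log (Real.sqrt (4 * Real.pi * t)))
    have ha' := abs_nonneg (Real.log (Real.sqrt (Real.pi * t)))
    have hb' := abs_nonneg (Real.log (Real.sqrt (4 * Real.pi * t)))
    constructor <;> linarith
  have hL0 : 0 ≤ L := by positivity
  nlinarith [mul_nonneg hL0 (sq_nonneg y), sq_nonneg y]

/-- The Gaussian smoothing solves the heat equation. -/
lemma hasDerivAt_heatDensity_time {s : ℝ} (hs : 0 < s) (y : ℝ) :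
    HasDerivAt (fun s => heatDensity μ s y)
      (1 / 2 * ∫ x, (((y - x) ^ 2 / s ^ 2 - 1 / s) * heatKernel s (y - x)) ∂μ) s := by
  obtain ⟨K, hK, hb⟩ := exists_heatKernel_bound hs
  rw [← integral_const_mul]
  have hc := continuous_heatKernel s
  refine (hasDerivAt_integral_of_dominated_loc_of_deriv_le (F := fun s x => heatKernel s (y - x))
    (F' := fun s x => 1 / 2 * (((y - x) ^ 2 / s ^ 2 - 1 / s) * heatKernel s (y - x)))
    (bound := fun _ => K * (1 + 4 * s))
    (Ioo_mem_nhds (by linarith : s / 2 < s) (by linarith : s < 2 * s))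
    (Filter.Eventually.of_forall fun z =>
      ((continuous_heatKernel z).comp (by fun_prop)).aestronglyMeasurable)
    (integrable_heatKernel y hs)
    (by apply Continuous.aestronglyMeasurable; fun_prop)
    (ae_of_all _ fun x z hz => ?_)
    (integrable_const _) (ae_of_all _ fun x z hz => ?_)).2
  · have h := hb z hz (fun u => u ^ 2 / z ^ 2 - 1 / z) (y - x) (abs_heat_weights_le hs hz _).2.2
    have h' := mul_le_mul_of_nonneg_left
      (gaussianEnvelope_le (by linarith : 0 < 4 * s) (y - x)) hK
    rw [norm_mul, Real.norm_eq_abs, Real.norm_eq_abs, abs_of_pos (by norm_num : (0 : ℝ) < 1 / 2)]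
    linarith [abs_nonneg (((y - x) ^ 2 / z ^ 2 - 1 / z) * heatKernel z (y - x))]
  · exact hasDerivAt_heatKernel_time (by linarith [hz.1]) _

/-- Cauchy–Schwarz bound for the score of the smoothed density. -/
lemma sq_div_heatDensity_le {s : ℝ} (hs : 0 < s) (y : ℝ)
    (h1 : Integrable (fun x => -((y - x) / s) * heatKernel s (y - x)) μ)
    (h2 : Integrable (fun x => (y - x) ^ 2 / s ^ 2 * heatKernel s (y - x)) μ) :
    (∫ x, -((y - x) / s) * heatKernel s (y - x) ∂μ) ^ 2 / heatDensity μ s y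
      ≤ ∫ x, (y - x) ^ 2 / s ^ 2 * heatKernel s (y - x) ∂μ := by
  have h0 := integrable_heatKernel (μ := μ) y hs
  have hpos := heatDensity_pos (μ := μ) hs y
  set D := ∫ x, -((y - x) / s) * heatKernel s (y - x) ∂μ with hD
  set l := D / heatDensity μ s y with hl
  have hnn : 0 ≤ ∫ x, ((y - x) ^ 2 / s ^ 2 * heatKernel s (y - x) -
      2 * l * (-((y - x) / s) * heatKernel s (y - x)) + l ^ 2 * heatKernel s (y - x)) ∂μ := by
    refine integral_nonneg fun x => ?_
    have := mul_nonneg (sq_nonneg ((y - x) / s + l)) (heatKernel_pos hs (y - x)).le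
    refine this.trans_eq ?_
    ring
  have h3 : Integrable (fun x => (y - x) ^ 2 / s ^ 2 * heatKernel s (y - x) -
      2 * l * (-((y - x) / s) * heatKernel s (y - x))) μ := h2.sub (h1.const_mul _)
  rw [integral_add h3 (h0.const_mul _),
    integral_sub h2 (h1.const_mul _), integral_const_mul, integral_const_mul, ← hD,
    ← heatDensity_eq] at hnn
  have e1 : 2 * l * D = 2 * (D ^ 2 / heatDensity μ s y) := by rw [hl]; ring
  have e2 : l ^ 2 * heatDensity μ s y = D ^ 2 / heatDensity μ s y := by rw [hl]; field_simp
  linarith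

theorem hasDerivAt_smoothedEntropy (hμ : Integrable (fun x => x ^ 2) μ) {t : ℝ} (ht : 0 < t) :
    HasDerivAt (smoothedEntropy μ) (1 / 2 * smoothedFisherInfo μ t) t := by
  obtain ⟨K, hK, hb⟩ := exists_heatKernel_bound ht
  obtain ⟨A, hA⟩ := exists_log_heatDensity_bound hμ ht
  have hc4 : 0 < 4 * t := by linarith
  have htI : t ∈ Set.Ioo (t / 2) (2 * t) := ⟨by linarith, by linarith⟩
  have hpos : ∀ s ∈ Set.Ioo (t / 2) (2 * t), 0 < s := fun s hs => by linarith [hs.1]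
  have hone : ∀ u : ℝ, |(1 : ℝ)| ≤ (1 + 2 / t + 4 / t ^ 2) * (1 + u ^ 2) := fun u => by
    rw [abs_one]
    have : 0 < 2 / t := by positivity
    have : 0 < 4 / t ^ 2 := by positivity
    nlinarith [sq_nonneg u]
  have b0 : ∀ s ∈ Set.Ioo (t / 2) (2 * t), ∀ u, |heatKernel s u| ≤ K * gaussianEnvelope (4 * t) u :=
    fun s hs u => by simpa using hb s hs (fun _ => 1) u (hone u)
  have b1 : ∀ s ∈ Set.Ioo (t / 2) (2 * t), ∀ u,
      |-(u / s) * heatKernel s u| ≤ K * gaussianEnvelope (4 * t) u :=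
    fun s hs u => hb s hs (fun u => -(u / s)) u
      (by rw [abs_neg]; exact (abs_heat_weights_le ht hs u).1)
  have bq : ∀ s ∈ Set.Ioo (t / 2) (2 * t), ∀ u,
      |u ^ 2 / s ^ 2 * heatKernel s u| ≤ K * gaussianEnvelope (4 * t) u :=
    fun s hs u => hb s hs (fun u => u ^ 2 / s ^ 2) u (abs_heat_weights_le ht hs u).2.1
  have b2 : ∀ s ∈ Set.Ioo (t / 2) (2 * t), ∀ u,
      |(u ^ 2 / s ^ 2 - 1 / s) * heatKernel s u| ≤ K * gaussianEnvelope (4 * t) u :=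
    fun s hs u => hb s hs (fun u => u ^ 2 / s ^ 2 - 1 / s) u (abs_heat_weights_le ht hs u).2.2
  have c0 := continuous_heatKernel
  have c1 : ∀ s, Continuous fun u => -(u / s) * heatKernel s u := fun s => by
    have := c0 s; fun_prop
  have cq : ∀ s, Continuous fun u => u ^ 2 / s ^ 2 * heatKernel s u := fun s => by
    have := c0 s; fun_prop
  have c2 : ∀ s, Continuous fun u => (u ^ 2 / s ^ 2 - 1 / s) * heatKernel s u := fun s => by
    have := c0 s; fun_prop
  set D1 : ℝ → ℝ := fun y => ∫ x, -((y - x) / t) * heatKernel t (y - x) ∂μ with hD1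
  set D2 : ℝ → ℝ → ℝ := fun s y =>
    ∫ x, ((y - x) ^ 2 / s ^ 2 - 1 / s) * heatKernel s (y - x) ∂μ with hD2
  have d0 : ∀ y, HasDerivAt (heatDensity μ t) (D1 y) y :=
    hasDerivAt_smoothing (c0 t) (c1 t) (hasDerivAt_heatKernel ht) hc4 hK (b0 t htI) (b1 t htI)
  have d1 : ∀ y, HasDerivAt D1 (D2 t y) y :=
    hasDerivAt_smoothing (c1 t) (c2 t) (hasDerivAt_heatKernel_deriv ht) hc4 hK
      (b1 t htI) (b2 t htI)
  have hmeas : ∀ s, Measurable (heatDensity μ s) := fun s =>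
    (stronglyMeasurable_smoothing (c0 s)).measurable
  have hlog : Measurable fun y => Real.log (heatDensity μ t y) := (hmeas t).log
  have hlogA : ∀ s ∈ Set.Ioo (t / 2) (2 * t), ∀ y,
      |Real.log (heatDensity μ s y) + 1| ≤ A * (1 + y ^ 2) := fun s hs y =>
    (abs_add_le _ _).trans (by simpa using hA s hs y)
  have hderiv : HasDerivAt (fun s => ∫ y, heatDensity μ s y * Real.log (heatDensity μ s y))
      (∫ y, 1 / 2 * D2 t y * (Real.log (heatDensity μ t y) + 1)) t := by
    refine (hasDerivAt_integral_of_dominated_loc_of_deriv_le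
      (F := fun s y => heatDensity μ s y * Real.log (heatDensity μ s y))
      (F' := fun s y => 1 / 2 * D2 s y * (Real.log (heatDensity μ s y) + 1))
      (bound := fun y => 1 / 2 * (K * A) *
        ((∫ x, gaussianEnvelope (4 * t) (y - x) ∂μ) * (1 + y ^ 2)))
      (Ioo_mem_nhds htI.1 htI.2)
      (Filter.Eventually.of_forall fun s => ((hmeas s).mul (hmeas s).log).aestronglyMeasurable)
      (integrable_smoothing_mul hμ (A := A) (c0 t) hc4 (b0 t htI) hlog
        (fun y => by linarith [hA t htI y]))
      ?_ (ae_of_all _ fun y s hs => ?_)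
      ((integrable_envelope_smoothing hμ hc4).const_mul _) (ae_of_all _ fun y s hs => ?_)).2
    · exact (((stronglyMeasurable_smoothing (c2 t)).measurable.const_mul (1 / 2)).mul
        (hlog.add_const 1)).aestronglyMeasurable
    · have h1 := abs_smoothing_le (μ := μ) hc4 (b2 s hs) y
      rw [Real.norm_eq_abs, abs_mul, abs_mul, abs_of_pos (by norm_num : (0 : ℝ) < 1 / 2)]
      have h2 := mul_le_mul h1 (hlogA s hs y) (abs_nonneg _) ((abs_nonneg _).trans h1)
      calc _ = 1 / 2 * (|D2 s y| * |Real.log (heatDensity μ s y) + 1|) := by ring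
        _ ≤ 1 / 2 * _ := mul_le_mul_of_nonneg_left h2 (by norm_num)
        _ = _ := by ring
    · have hp := heatDensity_pos (μ := μ) (hpos s hs) y
      have hd := hasDerivAt_heatDensity_time (μ := μ) (hpos s hs) y
      refine (hd.mul (hd.log hp.ne')).congr_deriv ?_
      simp only [hD2]
      field_simp
  have hparts : ∫ y, (Real.log (heatDensity μ t y) + 1) * D2 t y
      = -∫ y, D1 y / heatDensity μ t y * D1 y := by
    refine integral_mul_deriv_eq_deriv_mul_of_integrable
      (fun y _ => ((d0 y).log (heatDensity_pos ht y).ne').add_const 1) (fun y _ => d1 y) ?_ ?_ ?_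
    · exact (integrable_smoothing_mul hμ (c2 t) hc4 (b2 t htI) (hlog.add_const 1)
        (hlogA t htI)).congr (ae_of_all _ fun y => mul_comm _ _)
    · have hq : Integrable fun y => (∫ x, (y - x) ^ 2 / t ^ 2 * heatKernel t (y - x) ∂μ) * 1 :=
        integrable_smoothing_mul hμ (A := 1) (cq t) hc4 (bq t htI) measurable_const
          (fun y => by rw [abs_one]; nlinarith [sq_nonneg y])
      have hD1m : Measurable D1 := (stronglyMeasurable_smoothing (c1 t)).measurable
      refine Integrable.mono' hq ((hD1m.div (hmeas t)).mul hD1m).aestronglyMeasurable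
        (ae_of_all _ fun y => ?_)
      have hp := heatDensity_pos (μ := μ) ht y
      have e : D1 y / heatDensity μ t y * D1 y = D1 y ^ 2 / heatDensity μ t y := by ring
      simp only [Pi.mul_apply, mul_one]
      rw [e, Real.norm_of_nonneg (by positivity)]
      exact sq_div_heatDensity_le ht y (integrable_comp_sub (c1 t) hc4 hK (b1 t htI) y)
        (integrable_comp_sub (cq t) hc4 hK (bq t htI) y)
    · exact (integrable_smoothing_mul hμ (c1 t) hc4 (b1 t htI) (hlog.add_const 1)
        (hlogA t htI)).congr (ae_of_all _ fun y => mul_comm _ _)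
  refine hderiv.neg.congr_deriv ?_
  have e1 : ∫ y, 1 / 2 * D2 t y * (Real.log (heatDensity μ t y) + 1)
      = 1 / 2 * ∫ y, (Real.log (heatDensity μ t y) + 1) * D2 t y := by
    rw [← integral_const_mul]; congr 1; ext y; ring
  have e2 : smoothedFisherInfo μ t = ∫ y, D1 y / heatDensity μ t y * D1 y := by
    unfold smoothedFisherInfo
    congr 1; ext y; rw [(d0 y).deriv]; ring
  rw [e1, hparts, e2]
  ring

end HeatDensity

/-- **de Bruijn's identity**: if `X` has finite variance and `Z ~ N(0,1)` is independent
of `X`, then for every `t > 0`, `d/dt H(X + √t·Z) = (1/2) · J(X + √t·Z)`. -/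
theorem deBruijn_identity {Ω : Type*} [MeasurableSpace Ω] (P : Measure Ω)
    [IsProbabilityMeasure P] (X Z : Ω → ℝ) (hX : Measurable X) (hZ : Measurable Z)
    (hindep : IndepFun X Z P) (hZlaw : P.map Z = gaussianReal 0 1)
    (hX2 : Integrable (fun ω => (X ω) ^ 2) P)
    (t : ℝ) (ht : 0 < t) :
    HasDerivAt (fun s : ℝ => smoothedEntropy (P.map X) s)
      ((1 / 2) * smoothedFisherInfo (P.map X) t) t := by
  have := Measure.isProbabilityMeasure_map (μ := P) hX.aemeasurable
  refine hasDerivAt_smoothedEntropy ?_ ht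
  exact (integrable_map_measure (by fun_prop) hX.aemeasurable).2 hX2
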